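/- arXiv:2410.22114 — 3 statements merged into one kernel-verified Lean document; each statement's English description precedes it below -/
import Mathlib

section
/- Lipschitz continuity and smoothness of the softmax-parameterized objective: for every transition kernel p, the map θ ↦ J_ρ(π^θ, p) from ℝ^{S×A} to ℝ is Lipschitz continuous with constant L_θ = √2/(1−γ)², and its gradient is Lipschitz continuous with constant ℓ_θ = 8/(1−γ)³ (i.e., the map is 8/(1−γ)³-smooth). -/
open scoped BigOperators

noncomputable section

namespace RMDPStmt

variable {S A : ℕ}

/-- `p` is a transition kernel: each `p s a` lies in the probability simplex `Δ^S`. -/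
def IsKernel (p : Fin S → Fin A → Fin S → ℝ) : Prop :=
  ∀ s a, p s a ∈ stdSimplex ℝ (Fin S)

/-- `π` is a stationary randomized policy: each `π s` lies in the simplex `Δ^A`. -/
def IsPolicy (π : Fin S → Fin A → ℝ) : Prop :=
  ∀ s, π s ∈ stdSimplex ℝ (Fin A)

/-- The state-to-state matrix `P^π`. -/
def Pmat (π : Fin S → Fin A → ℝ) (p : Fin S → Fin A → Fin S → ℝ) :
    Matrix (Fin S) (Fin S) ℝ :=
  Matrix.of fun s s' => ∑ a, π s a * p s a s'

/-- The expected one-step cost vector `c^π`. -/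
def cvec (c : Fin S → Fin A → Fin S → ℝ) (π : Fin S → Fin A → ℝ)
    (p : Fin S → Fin A → Fin S → ℝ) : Fin S → ℝ :=
  fun s => ∑ a, π s a * ∑ s', p s a s' * c s a s'

/-- Value function `v^{π,p}` as a discounted series. -/
def value (γ : ℝ) (c : Fin S → Fin A → Fin S → ℝ) (π : Fin S → Fin A → ℝ)
    (p : Fin S → Fin A → Fin S → ℝ) : Fin S → ℝ :=
  fun s => ∑' t : ℕ, γ ^ t * ((Pmat π p ^ t).mulVec (cvec c π p)) s

/-- The return `J_ρ(π,p)`. -/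
def J (γ : ℝ) (c : Fin S → Fin A → Fin S → ℝ) (ρ : Fin S → ℝ)
    (π : Fin S → Fin A → ℝ) (p : Fin S → Fin A → Fin S → ℝ) : ℝ :=
  ∑ s, ρ s * value γ c π p s

/-- The action-value function `q^{π,p}`. -/
def qval (γ : ℝ) (c : Fin S → Fin A → Fin S → ℝ) (π : Fin S → Fin A → ℝ)
    (p : Fin S → Fin A → Fin S → ℝ) : Fin S → Fin A → ℝ :=
  fun s a => ∑ s', p s a s' * (c s a s' + γ * value γ c π p s')

/-- The discounted state occupancy measure `d^{π,p}_ρ`. -/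
def occ (γ : ℝ) (ρ : Fin S → ℝ) (π : Fin S → Fin A → ℝ)
    (p : Fin S → Fin A → Fin S → ℝ) : Fin S → ℝ :=
  fun s' => (1 - γ) * ∑' t : ℕ, γ ^ t * ∑ s, ρ s * (Pmat π p ^ t) s s'

/-- Bregman divergence generated by `h`. -/
def breg {E : Type*} [NormedAddCommGroup E] [NormedSpace ℝ E]
    (h : E → ℝ) (x y : E) : ℝ :=
  h x - h y - fderiv ℝ h y (x - y)

/-- Weighted Bregman divergence `B_μ`. -/
def bregW {E : Type*} [NormedAddCommGroup E] [NormedSpace ℝ E]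
    (μ : Fin S → ℝ) (h : E → ℝ) (x y : Fin S → E) : ℝ :=
  ∑ s, μ s * breg h (x s) (y s)

/-- Inner product of two action-indexed vectors. -/
def dotA (u v : Fin A → ℝ) : ℝ := ∑ a, u a * v a

/-- Inner product of two action-by-state arrays. -/
def dotAS (u v : Fin A → Fin S → ℝ) : ℝ := ∑ a, ∑ s', u a s' * v a s'

/-- The robust objective `Φ(π) = sup_{p ∈ Amb} J_ρ(π,p)`. -/
def Phi (γ : ℝ) (c : Fin S → Fin A → Fin S → ℝ) (ρ : Fin S → ℝ)
    (Amb : Set (Fin S → Fin A → Fin S → ℝ)) (π : Fin S → Fin A → ℝ) : ℝ :=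
  sSup ((fun p => J γ c ρ π p) '' Amb)

/-- The distribution mismatch coefficient
`M = sup_{π ∈ Π, p ∈ Amb} max_s d^{π,p}_ρ(s)/ρ_s`. -/
def mismatch (γ : ℝ) (ρ : Fin S → ℝ)
    (Amb : Set (Fin S → Fin A → Fin S → ℝ)) : ℝ :=
  sSup {x : ℝ | ∃ (π : Fin S → Fin A → ℝ) (p : Fin S → Fin A → Fin S → ℝ),
    IsPolicy π ∧ p ∈ Amb ∧ ∃ s, x = occ γ ρ π p s / ρ s}


/-- The softmax-parameterized policy `π^θ`. -/
def softmaxPolicy {S A : ℕ} (θ : EuclideanSpace ℝ (Fin S × Fin A)) :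
    Fin S → Fin A → ℝ :=
  fun s a => Real.exp (θ (s, a)) / ∑ a', Real.exp (θ (s, a'))

/-- The average of `x` against a probability vector is bounded by any bound on `|x|`. -/
theorem abs_average_le {ι : Type*} [Fintype ι] {w x : ι → ℝ} {B : ℝ}
    (hw : w ∈ stdSimplex ℝ ι) (hx : ∀ i, |x i| ≤ B) : |∑ i, w i * x i| ≤ B :=
  calc |∑ i, w i * x i| ≤ ∑ i, |w i * x i| := Finset.abs_sum_le_sum_abs _ _
    _ ≤ ∑ i, w i * B := Finset.sum_le_sum fun i _ => by
        rw [abs_mul, abs_of_nonneg (hw.1 i)]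
        exact mul_le_mul_of_nonneg_left (hx i) (hw.1 i)
    _ = B := by rw [← Finset.sum_mul, hw.2, one_mul]

/-- The covariance of two bounded functions is bounded by the product of the bounds. -/
theorem abs_covariance_le {ι : Type*} [Fintype ι] {w x y : ι → ℝ} {B C : ℝ}
    (hw : w ∈ stdSimplex ℝ ι) (hB : 0 ≤ B) (hx : ∀ i, |x i| ≤ B) (hy : ∀ i, |y i| ≤ C) :
    |∑ i, w i * (x i * y i) - (∑ i, w i * x i) * ∑ i, w i * y i| ≤ B * C := by
  rcases isEmpty_or_nonempty ι with hι | ⟨⟨i₀⟩⟩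
  · exact absurd hw.2 (by simp)
  have hC : 0 ≤ C := (abs_nonneg _).trans (hy i₀)
  set m := ∑ i, w i * x i with hm
  have hvar : ∑ i, w i * |x i - m| ^ 2 = ∑ i, w i * x i ^ 2 - m ^ 2 := by
    have h : ∀ i, w i * |x i - m| ^ 2 = w i * x i ^ 2 - 2 * m * (w i * x i) + m ^ 2 * w i := by
      intro i; rw [sq_abs]; ring
    simp_rw [h]
    rw [Finset.sum_add_distrib, Finset.sum_sub_distrib, ← Finset.mul_sum, ← Finset.mul_sum,
      hw.2, ← hm]
    ring
  have hsq : ∑ i, w i * x i ^ 2 ≤ B ^ 2 :=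
    (le_abs_self _).trans (abs_average_le hw fun i => by
      rw [abs_pow]; exact pow_le_pow_left₀ (abs_nonneg _) (hx i) 2)
  have hdev : ∑ i, w i * |x i - m| ≤ B := by
    refine le_of_sq_le_sq ?_ hB
    have := Real.pow_arith_mean_le_arith_mean_pow Finset.univ w (fun i => |x i - m|)
      (fun i _ => hw.1 i) hw.2 (fun i _ => abs_nonneg _) 2
    nlinarith [sq_nonneg m]
  have hcov : ∑ i, w i * (x i * y i) - m * ∑ i, w i * y i = ∑ i, w i * (x i - m) * y i := by
    rw [Finset.mul_sum, ← Finset.sum_sub_distrib]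
    exact Finset.sum_congr rfl fun i _ => by ring
  rw [hcov]
  calc |∑ i, w i * (x i - m) * y i| ≤ ∑ i, |w i * (x i - m) * y i| :=
        Finset.abs_sum_le_sum_abs _ _
    _ ≤ ∑ i, w i * |x i - m| * C := Finset.sum_le_sum fun i _ => by
        rw [abs_mul, abs_mul, abs_of_nonneg (hw.1 i)]
        exact mul_le_mul_of_nonneg_left (hy i) (mul_nonneg (hw.1 i) (abs_nonneg _))
    _ = (∑ i, w i * |x i - m|) * C := (Finset.sum_mul ..).symm
    _ ≤ B * C := mul_le_mul_of_nonneg_right hdev hC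

/-- Maximum principle for the discounted Bellman operator of a policy. -/
theorem abs_le_of_fixedPoint {γ : ℝ} (hγ : γ ∈ Set.Ioo (0 : ℝ) 1)
    {p : Fin S → Fin A → Fin S → ℝ} (hp : IsKernel p) {π : Fin S → Fin A → ℝ}
    (hπ : IsPolicy π) {w g : Fin S → ℝ} {B : ℝ} (hg : ∀ s, |g s| ≤ B)
    (hw : ∀ s, w s = g s + γ * ∑ a, π s a * ∑ s', p s a s' * w s') (s : Fin S) :
    |w s| ≤ B / (1 - γ) := by
  obtain ⟨m, -, hm⟩ := Finset.exists_max_image Finset.univ (fun i => |w i|)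
    ⟨s, Finset.mem_univ s⟩
  have havg : |∑ a, π m a * ∑ s', p m a s' * w s'| ≤ |w m| :=
    abs_average_le (hπ m) fun a => abs_average_le (hp m a) fun s' => hm s' (Finset.mem_univ _)
  have h : |w m| ≤ B + γ * |w m| := by
    conv_lhs => rw [hw m]
    refine (abs_add_le _ _).trans (add_le_add (hg m) ?_)
    rw [abs_mul, abs_of_pos hγ.1]
    exact mul_le_mul_of_nonneg_left havg hγ.1.le
  refine (hm s (Finset.mem_univ _)).trans ?_
  rw [le_div_iff₀ (by linarith [hγ.2])]
  linarith

theorem Pmat_mulVec (π : Fin S → Fin A → ℝ) (p : Fin S → Fin A → Fin S → ℝ)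
    (x : Fin S → ℝ) (s : Fin S) :
    (Pmat π p).mulVec x s = ∑ a, π s a * ∑ s', p s a s' * x s' := by
  simp only [Pmat, Matrix.mulVec, dotProduct, Matrix.of_apply, Finset.sum_mul, Finset.mul_sum]
  rw [Finset.sum_comm]
  exact Finset.sum_congr rfl fun a _ => Finset.sum_congr rfl fun s' _ => by ring

theorem abs_Pmat_pow_mulVec_cvec_le {c : Fin S → Fin A → Fin S → ℝ}
    (hc : ∀ s a s', c s a s' ∈ Set.Icc (0 : ℝ) 1)
    {p : Fin S → Fin A → Fin S → ℝ} (hp : IsKernel p) {π : Fin S → Fin A → ℝ}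
    (hπ : IsPolicy π) (t : ℕ) (s : Fin S) :
    |((Pmat π p ^ t).mulVec (cvec c π p)) s| ≤ 1 := by
  induction t generalizing s with
  | zero =>
    rw [pow_zero, Matrix.one_mulVec]
    exact abs_average_le (hπ s) fun a => abs_average_le (hp s a) fun s' => by
      rw [abs_of_nonneg (hc s a s').1]; exact (hc s a s').2
  | succ t ih =>
    rw [pow_succ', ← Matrix.mulVec_mulVec, Pmat_mulVec]
    exact abs_average_le (hπ s) fun a => abs_average_le (hp s a) ih

theorem value_eq_cvec_add {γ : ℝ} (hγ : γ ∈ Set.Ioo (0 : ℝ) 1)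
    {c : Fin S → Fin A → Fin S → ℝ} (hc : ∀ s a s', c s a s' ∈ Set.Icc (0 : ℝ) 1)
    {p : Fin S → Fin A → Fin S → ℝ} (hp : IsKernel p) {π : Fin S → Fin A → ℝ}
    (hπ : IsPolicy π) (s : Fin S) :
    value γ c π p s = cvec c π p s + γ * (Pmat π p).mulVec (value γ c π p) s := by
  have hsum : ∀ s, Summable fun t : ℕ => γ ^ t * ((Pmat π p ^ t).mulVec (cvec c π p)) s := by
    intro s
    refine Summable.of_norm_bounded (summable_geometric_of_lt_one hγ.1.le hγ.2) fun t => ?_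
    rw [Real.norm_eq_abs, abs_mul, abs_of_nonneg (pow_nonneg hγ.1.le t)]
    exact mul_le_of_le_one_right (pow_nonneg hγ.1.le t) (abs_Pmat_pow_mulVec_cvec_le hc hp hπ t s)
  have hstep : ∀ t : ℕ, γ ^ (t + 1) * ((Pmat π p ^ (t + 1)).mulVec (cvec c π p)) s =
      ∑ s', γ * Pmat π p s s' * (γ ^ t * ((Pmat π p ^ t).mulVec (cvec c π p)) s') := by
    intro t
    rw [pow_succ' (Pmat π p), ← Matrix.mulVec_mulVec, Matrix.mulVec, dotProduct, Finset.mul_sum]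
    exact Finset.sum_congr rfl fun s' _ => by ring
  rw [value, (hsum s).tsum_eq_zero_add]
  simp_rw [hstep]
  rw [Summable.tsum_finsetSum fun s' _ => (hsum s').mul_left _]
  simp_rw [tsum_mul_left]
  rw [pow_zero, pow_zero, Matrix.one_mulVec, one_mul, Matrix.mulVec, dotProduct, Finset.mul_sum]
  congr 1
  exact Finset.sum_congr rfl fun s' _ => mul_assoc _ _ _

theorem value_eq_sum_qval {γ : ℝ} (hγ : γ ∈ Set.Ioo (0 : ℝ) 1)
    {c : Fin S → Fin A → Fin S → ℝ} (hc : ∀ s a s', c s a s' ∈ Set.Icc (0 : ℝ) 1)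
    {p : Fin S → Fin A → Fin S → ℝ} (hp : IsKernel p) {π : Fin S → Fin A → ℝ}
    (hπ : IsPolicy π) (s : Fin S) :
    value γ c π p s = ∑ a, π s a * qval γ c π p s a := by
  rw [value_eq_cvec_add hγ hc hp hπ, Pmat_mulVec, cvec, Finset.mul_sum,
    ← Finset.sum_add_distrib]
  refine Finset.sum_congr rfl fun a _ => ?_
  simp only [qval, mul_add, Finset.sum_add_distrib, Finset.mul_sum]
  congr 1
  exact Finset.sum_congr rfl fun s' _ => by ring

theorem abs_value_le {γ : ℝ} (hγ : γ ∈ Set.Ioo (0 : ℝ) 1)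
    {c : Fin S → Fin A → Fin S → ℝ} (hc : ∀ s a s', c s a s' ∈ Set.Icc (0 : ℝ) 1)
    {p : Fin S → Fin A → Fin S → ℝ} (hp : IsKernel p) {π : Fin S → Fin A → ℝ}
    (hπ : IsPolicy π) (s : Fin S) : |value γ c π p s| ≤ 1 / (1 - γ) := by
  refine abs_le_of_fixedPoint hγ hp hπ (g := cvec c π p) (fun s => ?_) (fun s => ?_) s
  · simpa using abs_Pmat_pow_mulVec_cvec_le hc hp hπ 0 s
  · rw [← Pmat_mulVec]; exact value_eq_cvec_add hγ hc hp hπ s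

theorem abs_qval_le {γ : ℝ} (hγ : γ ∈ Set.Ioo (0 : ℝ) 1)
    {c : Fin S → Fin A → Fin S → ℝ} (hc : ∀ s a s', c s a s' ∈ Set.Icc (0 : ℝ) 1)
    {p : Fin S → Fin A → Fin S → ℝ} (hp : IsKernel p) {π : Fin S → Fin A → ℝ}
    (hπ : IsPolicy π) (s : Fin S) (a : Fin A) : |qval γ c π p s a| ≤ 1 / (1 - γ) := by
  refine abs_average_le (hp s a) fun s' => (abs_add_le _ _).trans ?_
  have h1 : |c s a s'| ≤ 1 := by rw [abs_of_nonneg (hc s a s').1]; exact (hc s a s').2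
  have h2 : |γ * value γ c π p s'| ≤ γ * (1 / (1 - γ)) := by
    rw [abs_mul, abs_of_pos hγ.1]
    exact mul_le_mul_of_nonneg_left (abs_value_le hγ hc hp hπ s') hγ.1.le
  have h3 : 1 + γ * (1 / (1 - γ)) = 1 / (1 - γ) := by
    have : 1 - γ ≠ 0 := by linarith [hγ.2]
    field_simp
    ring
  linarith

theorem qval_sub_qval (γ : ℝ) (c : Fin S → Fin A → Fin S → ℝ) (p : Fin S → Fin A → Fin S → ℝ)
    (π₁ π₂ : Fin S → Fin A → ℝ) (s : Fin S) (a : Fin A) :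
    qval γ c π₁ p s a - qval γ c π₂ p s a =
      γ * ∑ s', p s a s' * (value γ c π₁ p s' - value γ c π₂ p s') := by
  rw [qval, qval, ← Finset.sum_sub_distrib, Finset.mul_sum]
  exact Finset.sum_congr rfl fun s' _ => by ring

theorem softmaxPolicy_isPolicy (hA : 0 < A) (θ : EuclideanSpace ℝ (Fin S × Fin A)) :
    IsPolicy (softmaxPolicy θ) := by
  have : Nonempty (Fin A) := ⟨⟨0, hA⟩⟩
  intro s
  have hZ : 0 < ∑ a', Real.exp (θ (s, a')) :=
    Finset.sum_pos (fun a _ => Real.exp_pos _) Finset.univ_nonempty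
  refine ⟨fun a => div_nonneg (Real.exp_pos _).le hZ.le, ?_⟩
  simp only [softmaxPolicy]
  rw [← Finset.sum_div, div_self hZ.ne']

/-- The Fréchet derivative of `θ ↦ π^θ_{sa}`. -/
def softmaxDeriv (θ : EuclideanSpace ℝ (Fin S × Fin A)) (s : Fin S) (a : Fin A) :
    EuclideanSpace ℝ (Fin S × Fin A) →L[ℝ] ℝ :=
  softmaxPolicy θ s a • (EuclideanSpace.proj (s, a) -
    ∑ b, softmaxPolicy θ s b • EuclideanSpace.proj (s, b))

theorem softmaxDeriv_apply (θ u : EuclideanSpace ℝ (Fin S × Fin A)) (s : Fin S) (a : Fin A) :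
    softmaxDeriv θ s a u =
      softmaxPolicy θ s a * (u (s, a) - ∑ b, softmaxPolicy θ s b * u (s, b)) := by
  simp [softmaxDeriv]

theorem hasFDerivAt_softmaxPolicy (hA : 0 < A) (θ : EuclideanSpace ℝ (Fin S × Fin A))
    (s : Fin S) (a : Fin A) :
    HasFDerivAt (fun θ : EuclideanSpace ℝ (Fin S × Fin A) => softmaxPolicy θ s a)
      (softmaxDeriv θ s a) θ := by
  have : Nonempty (Fin A) := ⟨⟨0, hA⟩⟩
  have hZ : 0 < ∑ a', Real.exp (θ (s, a')) :=
    Finset.sum_pos (fun a _ => Real.exp_pos _) Finset.univ_nonempty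
  have hexp : ∀ b : Fin A, HasFDerivAt
      (fun θ : EuclideanSpace ℝ (Fin S × Fin A) => Real.exp (θ (s, b)))
      (Real.exp (θ (s, b)) • (EuclideanSpace.proj (s, b) :
        EuclideanSpace ℝ (Fin S × Fin A) →L[ℝ] ℝ)) θ := fun b =>
    ((EuclideanSpace.proj (s, b) :
        EuclideanSpace ℝ (Fin S × Fin A) →L[ℝ] ℝ).hasFDerivAt (x := θ)).exp
  have hinv := (hasDerivAt_inv hZ.ne').comp_hasFDerivAt θ
    (HasFDerivAt.fun_sum (u := Finset.univ) fun b _ => hexp b)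
  simp only [softmaxPolicy, div_eq_mul_inv]
  refine ((hexp a).mul hinv).congr_fderiv ?_
  ext u
  rw [softmaxDeriv_apply]
  simp only [softmaxPolicy, div_mul_eq_mul_div, ← Finset.sum_div]
  simp
  field_simp
  ring

theorem sum_softmaxDeriv_mul (θ u : EuclideanSpace ℝ (Fin S × Fin A)) (s : Fin S)
    (b : Fin A → ℝ) :
    ∑ a, softmaxDeriv θ s a u * b a =
      ∑ a, softmaxPolicy θ s a * (u (s, a) * b a) -
        (∑ a, softmaxPolicy θ s a * u (s, a)) * ∑ a, softmaxPolicy θ s a * b a := by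
  simp only [softmaxDeriv_apply]
  rw [Finset.mul_sum, ← Finset.sum_sub_distrib]
  exact Finset.sum_congr rfl fun a _ => by ring

theorem abs_sum_softmaxDeriv_mul_le (hA : 0 < A) (θ u : EuclideanSpace ℝ (Fin S × Fin A))
    (s : Fin S) {b : Fin A → ℝ} {B : ℝ} (hb : ∀ a, |b a| ≤ B) :
    |∑ a, softmaxDeriv θ s a u * b a| ≤ ‖u‖ * B := by
  rw [sum_softmaxDeriv_mul]
  exact abs_covariance_le (softmaxPolicy_isPolicy hA θ s) (norm_nonneg u)
    (fun a => PiLp.norm_apply_le u (s, a)) hb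

theorem abs_sum_softmaxPolicy_mul_sub_le (hA : 0 < A)
    (θ₁ θ₂ : EuclideanSpace ℝ (Fin S × Fin A)) (s : Fin S) {b : Fin A → ℝ} {B : ℝ}
    (hb : ∀ a, |b a| ≤ B) :
    |∑ a, softmaxPolicy θ₁ s a * b a - ∑ a, softmaxPolicy θ₂ s a * b a| ≤
      B * ‖θ₁ - θ₂‖ := by
  have hB : 0 ≤ B := (abs_nonneg _).trans (hb ⟨0, hA⟩)
  have hderiv : ∀ θ : EuclideanSpace ℝ (Fin S × Fin A), HasFDerivAt
      (fun θ : EuclideanSpace ℝ (Fin S × Fin A) => ∑ a, softmaxPolicy θ s a * b a)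
      (∑ a, b a • softmaxDeriv θ s a) θ := fun θ =>
    HasFDerivAt.fun_sum fun a _ => (hasFDerivAt_softmaxPolicy hA θ s a).mul_const (b a)
  refine (convex_univ (𝕜 := ℝ)).norm_image_sub_le_of_norm_hasFDerivWithin_le
    (fun θ _ => (hderiv θ).hasFDerivWithinAt) (fun θ _ => ?_) (Set.mem_univ θ₂) (Set.mem_univ θ₁)
  refine ContinuousLinearMap.opNorm_le_bound _ hB fun u => ?_
  have h := abs_sum_softmaxDeriv_mul_le hA θ u s hb
  simpa [mul_comm] using h

theorem abs_sum_softmaxDeriv_sub_le (hA : 0 < A)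
    (θ₁ θ₂ u : EuclideanSpace ℝ (Fin S × Fin A)) (s : Fin S) {b : Fin A → ℝ} {B : ℝ}
    (hb : ∀ a, |b a| ≤ B) :
    |∑ a, softmaxDeriv θ₁ s a u * b a - ∑ a, softmaxDeriv θ₂ s a u * b a| ≤
      3 * (‖u‖ * B * ‖θ₁ - θ₂‖) := by
  have hB : 0 ≤ B := (abs_nonneg _).trans (hb ⟨0, hA⟩)
  have hu : ∀ a, |u (s, a)| ≤ ‖u‖ := fun a => PiLp.norm_apply_le u (s, a)
  have hub : ∀ a, |u (s, a) * b a| ≤ ‖u‖ * B := fun a => by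
    rw [abs_mul]; exact mul_le_mul (hu a) (hb a) (abs_nonneg _) (norm_nonneg _)
  have h1 := abs_sum_softmaxPolicy_mul_sub_le hA θ₁ θ₂ s hub
  have h2 := abs_sum_softmaxPolicy_mul_sub_le hA θ₁ θ₂ s hu
  have h3 := abs_sum_softmaxPolicy_mul_sub_le hA θ₁ θ₂ s hb
  have h4 := abs_average_le (softmaxPolicy_isPolicy hA θ₂ s) hu
  have h5 := abs_average_le (softmaxPolicy_isPolicy hA θ₁ s) hb
  rw [sum_softmaxDeriv_mul, sum_softmaxDeriv_mul]
  set X₁ := ∑ a, softmaxPolicy θ₁ s a * (u (s, a) * b a)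
  set X₂ := ∑ a, softmaxPolicy θ₂ s a * (u (s, a) * b a)
  set U₁ := ∑ a, softmaxPolicy θ₁ s a * u (s, a)
  set U₂ := ∑ a, softmaxPolicy θ₂ s a * u (s, a)
  set B₁ := ∑ a, softmaxPolicy θ₁ s a * b a
  set B₂ := ∑ a, softmaxPolicy θ₂ s a * b a
  have h6 : |(U₁ - U₂) * B₁| ≤ ‖u‖ * ‖θ₁ - θ₂‖ * B := by
    rw [abs_mul]; exact mul_le_mul h2 h5 (abs_nonneg _) (by positivity)
  have h7 : |U₂ * (B₁ - B₂)| ≤ ‖u‖ * (B * ‖θ₁ - θ₂‖) := by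
    rw [abs_mul]; exact mul_le_mul h4 h3 (abs_nonneg _) (norm_nonneg _)
  have h8 : X₁ - U₁ * B₁ - (X₂ - U₂ * B₂) =
      (X₁ - X₂) - (U₁ - U₂) * B₁ - U₂ * (B₁ - B₂) := by ring
  rw [h8]
  linarith [abs_sub (X₁ - X₂ - (U₁ - U₂) * B₁) (U₂ * (B₁ - B₂)),
    abs_sub (X₁ - X₂) ((U₁ - U₂) * B₁)]

theorem abs_value_softmaxPolicy_sub_le (hA : 0 < A) {γ : ℝ} (hγ : γ ∈ Set.Ioo (0 : ℝ) 1)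
    {c : Fin S → Fin A → Fin S → ℝ} (hc : ∀ s a s', c s a s' ∈ Set.Icc (0 : ℝ) 1)
    {p : Fin S → Fin A → Fin S → ℝ} (hp : IsKernel p)
    (θ₁ θ₂ : EuclideanSpace ℝ (Fin S × Fin A)) (s : Fin S) :
    |value γ c (softmaxPolicy θ₁) p s - value γ c (softmaxPolicy θ₂) p s| ≤
      1 / (1 - γ) * ‖θ₁ - θ₂‖ / (1 - γ) := by
  have hπ₁ := softmaxPolicy_isPolicy hA θ₁
  have hπ₂ := softmaxPolicy_isPolicy hA θ₂
  refine abs_le_of_fixedPoint hγ hp hπ₂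
    (w := fun s => value γ c (softmaxPolicy θ₁) p s - value γ c (softmaxPolicy θ₂) p s)
    (fun s => abs_sum_softmaxPolicy_mul_sub_le hA θ₁ θ₂ s (abs_qval_le hγ hc hp hπ₁ s))
    (fun s => ?_) s
  rw [value_eq_sum_qval hγ hc hp hπ₁ s, value_eq_sum_qval hγ hc hp hπ₂ s, Finset.mul_sum,
    ← Finset.sum_sub_distrib, ← Finset.sum_sub_distrib, ← Finset.sum_add_distrib]
  refine Finset.sum_congr rfl fun a _ => ?_
  rw [mul_left_comm, ← qval_sub_qval]
  ring

theorem differentiable_det {E n : Type*} [NormedAddCommGroup E] [NormedSpace ℝ E] [Fintype n]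
    [DecidableEq n] {M : E → Matrix n n ℝ} (hM : ∀ i j, Differentiable ℝ fun x => M x i j) :
    Differentiable ℝ fun x => (M x).det := by
  simp only [Matrix.det_apply]
  fun_prop

theorem differentiable_value_softmaxPolicy (hA : 0 < A) {γ : ℝ} (hγ : γ ∈ Set.Ioo (0 : ℝ) 1)
    {c : Fin S → Fin A → Fin S → ℝ} (hc : ∀ s a s', c s a s' ∈ Set.Icc (0 : ℝ) 1)
    {p : Fin S → Fin A → Fin S → ℝ} (hp : IsKernel p) (s : Fin S) :
    Differentiable ℝ fun θ : EuclideanSpace ℝ (Fin S × Fin A) =>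
      value γ c (softmaxPolicy θ) p s := by
  have hsm : ∀ s a, Differentiable ℝ fun θ : EuclideanSpace ℝ (Fin S × Fin A) =>
      softmaxPolicy θ s a := fun s a θ => (hasFDerivAt_softmaxPolicy hA θ s a).differentiableAt
  let M : EuclideanSpace ℝ (Fin S × Fin A) → Matrix (Fin S) (Fin S) ℝ :=
    fun θ => 1 - γ • Pmat (softmaxPolicy θ) p
  have hM : ∀ i j, Differentiable ℝ fun θ => M θ i j := by
    intro i j
    simp only [M, Pmat, Matrix.sub_apply, Matrix.smul_apply, Matrix.of_apply, smul_eq_mul]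
    fun_prop
  have hMmul : ∀ θ x i, (M θ).mulVec x i =
      x i - γ * ∑ a, softmaxPolicy θ i a * ∑ s', p i a s' * x s' := by
    intro θ x i
    simp only [M]
    rw [Matrix.sub_mulVec, Matrix.one_mulVec, Matrix.smul_mulVec, Pi.sub_apply, Pi.smul_apply,
      smul_eq_mul, Pmat_mulVec]
  have hdet : ∀ θ, (M θ).det ≠ 0 := by
    intro θ h0
    obtain ⟨x, hx0, hx⟩ := Matrix.exists_mulVec_eq_zero_iff.mpr h0
    refine hx0 (funext fun i => ?_)
    have h := abs_le_of_fixedPoint hγ hp (softmaxPolicy_isPolicy hA θ) (w := x) (g := 0) (B := 0)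
      (fun s => by simp) (fun s => by
        have := congrFun hx s
        rw [hMmul, Pi.zero_apply] at this
        rw [Pi.zero_apply]
        linarith) i
    simpa using h
  have hval : (fun θ => value γ c (softmaxPolicy θ) p s) = fun θ =>
      ((M θ).updateCol s (cvec c (softmaxPolicy θ) p)).det / (M θ).det := by
    funext θ
    have hbell : (M θ).mulVec (value γ c (softmaxPolicy θ) p) = cvec c (softmaxPolicy θ) p := by
      funext i
      rw [hMmul, ← Pmat_mulVec]
      linarith [value_eq_cvec_add hγ hc hp (softmaxPolicy_isPolicy hA θ) i]
    rw [eq_div_iff (hdet θ), ← Matrix.cramer_apply, ← hbell, Matrix.cramer_eq_adjugate_mulVec,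
      Matrix.mulVec_mulVec, Matrix.adjugate_mul, Matrix.smul_mulVec, Matrix.one_mulVec,
      Pi.smul_apply, smul_eq_mul, mul_comm]
  simp only [hval, div_eq_mul_inv]
  refine Differentiable.fun_mul (differentiable_det fun i j => ?_)
    ((differentiable_det hM).inv hdet)
  by_cases hj : j = s
  · subst hj
    simp only [Matrix.updateCol_self, cvec]
    fun_prop
  · simpa only [Matrix.updateCol_ne hj] using hM i j

/-- The differentiated Bellman equation. -/
theorem fderiv_value_softmaxPolicy (hA : 0 < A) {γ : ℝ} (hγ : γ ∈ Set.Ioo (0 : ℝ) 1)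
    {c : Fin S → Fin A → Fin S → ℝ} (hc : ∀ s a s', c s a s' ∈ Set.Icc (0 : ℝ) 1)
    {p : Fin S → Fin A → Fin S → ℝ} (hp : IsKernel p)
    (θ u : EuclideanSpace ℝ (Fin S × Fin A)) (s : Fin S) :
    fderiv ℝ (fun θ => value γ c (softmaxPolicy θ) p s) θ u =
      ∑ a, softmaxDeriv θ s a u * qval γ c (softmaxPolicy θ) p s a +
        γ * ∑ a, softmaxPolicy θ s a *
          ∑ s', p s a s' * fderiv ℝ (fun θ => value γ c (softmaxPolicy θ) p s') θ u := by
  have hv : ∀ s, HasFDerivAt (fun θ => value γ c (softmaxPolicy θ) p s)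
      (fderiv ℝ (fun θ => value γ c (softmaxPolicy θ) p s) θ) θ := fun s =>
    (differentiable_value_softmaxPolicy hA hγ hc hp s θ).hasFDerivAt
  have hq : ∀ a, HasFDerivAt (fun θ => qval γ c (softmaxPolicy θ) p s a)
      (∑ s', p s a s' • γ • fderiv ℝ (fun θ => value γ c (softmaxPolicy θ) p s') θ) θ :=
    fun a => HasFDerivAt.fun_sum fun s' _ => (((hv s').const_mul γ).const_add _).const_mul _
  have hsum := HasFDerivAt.fun_sum (u := Finset.univ) fun a _ =>
    (hasFDerivAt_softmaxPolicy hA θ s a).mul (hq a)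
  have heq : (fun θ => value γ c (softmaxPolicy θ) p s) =
      fun θ => ∑ a, softmaxPolicy θ s a * qval γ c (softmaxPolicy θ) p s a :=
    funext fun θ => value_eq_sum_qval hγ hc hp (softmaxPolicy_isPolicy hA θ) s
  have hfd := (hsum.congr_of_eventuallyEq (.of_eq heq)).fderiv
  conv_lhs => rw [hfd]
  simp only [sum_apply, add_apply, smul_apply, smul_eq_mul]
  rw [Finset.mul_sum, ← Finset.sum_add_distrib]
  refine Finset.sum_congr rfl fun a _ => ?_
  rw [add_comm, mul_comm (softmaxDeriv θ s a u), mul_left_comm γ, Finset.mul_sum (a := γ)]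
  congr 2
  exact Finset.sum_congr rfl fun s' _ => by ring

theorem abs_fderiv_value_softmaxPolicy_le (hA : 0 < A) {γ : ℝ} (hγ : γ ∈ Set.Ioo (0 : ℝ) 1)
    {c : Fin S → Fin A → Fin S → ℝ} (hc : ∀ s a s', c s a s' ∈ Set.Icc (0 : ℝ) 1)
    {p : Fin S → Fin A → Fin S → ℝ} (hp : IsKernel p)
    (θ u : EuclideanSpace ℝ (Fin S × Fin A)) (s : Fin S) :
    |fderiv ℝ (fun θ => value γ c (softmaxPolicy θ) p s) θ u| ≤
      ‖u‖ * (1 / (1 - γ)) / (1 - γ) :=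
  abs_le_of_fixedPoint hγ hp (softmaxPolicy_isPolicy hA θ)
    (fun s => abs_sum_softmaxDeriv_mul_le hA θ u s
      (abs_qval_le hγ hc hp (softmaxPolicy_isPolicy hA θ) s))
    (fun s => fderiv_value_softmaxPolicy hA hγ hc hp θ u s) s

theorem abs_fderiv_value_softmaxPolicy_sub_le (hA : 0 < A) {γ : ℝ}
    (hγ : γ ∈ Set.Ioo (0 : ℝ) 1) {c : Fin S → Fin A → Fin S → ℝ}
    (hc : ∀ s a s', c s a s' ∈ Set.Icc (0 : ℝ) 1)
    {p : Fin S → Fin A → Fin S → ℝ} (hp : IsKernel p)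
    (θ₁ θ₂ u : EuclideanSpace ℝ (Fin S × Fin A)) (s : Fin S) :
    |fderiv ℝ (fun θ => value γ c (softmaxPolicy θ) p s) θ₁ u -
      fderiv ℝ (fun θ => value γ c (softmaxPolicy θ) p s) θ₂ u| ≤
      8 / (1 - γ) ^ 3 * ‖θ₁ - θ₂‖ * ‖u‖ := by
  have hγ' : 0 < 1 - γ := by linarith [hγ.2]
  set π₁ := softmaxPolicy θ₁
  set π₂ := softmaxPolicy θ₂
  have hπ₁ : IsPolicy π₁ := softmaxPolicy_isPolicy hA θ₁
  have hπ₂ : IsPolicy π₂ := softmaxPolicy_isPolicy hA θ₂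
  set w₁ : Fin S → ℝ := fun s => fderiv ℝ (fun θ => value γ c (softmaxPolicy θ) p s) θ₁ u
    with hw₁
  set w₂ : Fin S → ℝ := fun s => fderiv ℝ (fun θ => value γ c (softmaxPolicy θ) p s) θ₂ u
    with hw₂
  set q₁ := qval γ c π₁ p
  set q₂ := qval γ c π₂ p
  set D := ‖θ₁ - θ₂‖ with hD
  set r := 1 / (1 - γ) with hr
  have hD0 : 0 ≤ D := norm_nonneg _
  have hr1 : 1 ≤ r := by rw [hr, le_div_iff₀ hγ']; linarith [hγ.1]
  have hγr : ∀ x : ℝ, x / (1 - γ) = x * r := fun x => by rw [hr]; ring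
  let g : Fin S → ℝ := fun s =>
    (∑ a, softmaxDeriv θ₁ s a u * q₁ s a - ∑ a, softmaxDeriv θ₂ s a u * q₁ s a) +
    ∑ a, softmaxDeriv θ₂ s a u * (q₁ s a - q₂ s a) +
    γ * (∑ a, π₁ s a * ∑ s', p s a s' * w₁ s' - ∑ a, π₂ s a * ∑ s', p s a s' * w₁ s')
  have hg : ∀ s, |g s| ≤ 5 * (r ^ 2 * D * ‖u‖) := by
    intro s
    have h1 := abs_sum_softmaxDeriv_sub_le hA θ₁ θ₂ u s (abs_qval_le hγ hc hp hπ₁ s)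
    have hq : ∀ a, |q₁ s a - q₂ s a| ≤ r * D * r := fun a => by
      rw [qval_sub_qval, abs_mul, abs_of_pos hγ.1]
      have h := abs_average_le (hp s a)
        (abs_value_softmaxPolicy_sub_le hA hγ hc hp θ₁ θ₂)
      rw [hγr] at h
      nlinarith [hγ.1, hγ.2, abs_nonneg (∑ s', p s a s' *
        (value γ c (softmaxPolicy θ₁) p s' - value γ c (softmaxPolicy θ₂) p s'))]
    have h2 := abs_sum_softmaxDeriv_mul_le hA θ₂ u s hq
    have h3 := abs_sum_softmaxPolicy_mul_sub_le hA θ₁ θ₂ s fun a =>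
      abs_average_le (hp s a) (abs_fderiv_value_softmaxPolicy_le hA hγ hc hp θ₁ u)
    rw [hγr] at h3
    have h4 : |γ * (∑ a, π₁ s a * ∑ s', p s a s' * w₁ s' -
        ∑ a, π₂ s a * ∑ s', p s a s' * w₁ s')| ≤ ‖u‖ * r * r * D := by
      rw [abs_mul, abs_of_pos hγ.1]
      exact (mul_le_of_le_one_left (abs_nonneg _) hγ.2.le).trans h3
    have h5 : ‖u‖ * r * D ≤ r ^ 2 * D * ‖u‖ := by
      nlinarith [mul_nonneg (mul_nonneg (norm_nonneg u) hD0)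
        (mul_nonneg (zero_le_one.trans hr1) (sub_nonneg.mpr hr1))]
    refine (abs_add_le _ _).trans ?_
    refine (add_le_add (abs_add_le _ _) le_rfl).trans ?_
    nlinarith [h1, h2, h4, h5]
  have hfix : ∀ s, w₁ s - w₂ s =
      g s + γ * ∑ a, π₂ s a * ∑ s', p s a s' * (w₁ s' - w₂ s') := by
    intro s
    simp only [g, hw₁, hw₂]
    rw [fderiv_value_softmaxPolicy hA hγ hc hp θ₁ u s,
      fderiv_value_softmaxPolicy hA hγ hc hp θ₂ u s]
    simp only [mul_sub, Finset.sum_sub_distrib]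
    ring
  have h := abs_le_of_fixedPoint hγ hp hπ₂ (w := fun s => w₁ s - w₂ s) hg hfix s
  refine h.trans ?_
  have h8 : 8 / (1 - γ) ^ 3 = 8 * r ^ 3 := by rw [hr, one_div_pow, mul_one_div]
  rw [hγr, h8]
  have : 0 ≤ r ^ 3 * D * ‖u‖ := by positivity
  linarith

/-- Lipschitz continuity and smoothness of the softmax-parameterized objective:
`θ ↦ J_ρ(π^θ, p)` is `√2/(1-γ)²`-Lipschitz and `8/(1-γ)³`-smooth. -/
theorem softmax_objective_lipschitz_and_smooth
    {S A : ℕ} (hS : 0 < S) (hA : 0 < A)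
    (γ : ℝ) (hγ : γ ∈ Set.Ioo (0 : ℝ) 1)
    (c : Fin S → Fin A → Fin S → ℝ)
    (hc : ∀ s a s', c s a s' ∈ Set.Icc (0 : ℝ) 1)
    (ρ : Fin S → ℝ) (hρ : ρ ∈ stdSimplex ℝ (Fin S))
    (p : Fin S → Fin A → Fin S → ℝ) (hp : IsKernel p) :
    (∀ θ₁ θ₂ : EuclideanSpace ℝ (Fin S × Fin A),
        |J γ c ρ (softmaxPolicy θ₁) p - J γ c ρ (softmaxPolicy θ₂) p| ≤
          Real.sqrt 2 / (1 - γ) ^ 2 * ‖θ₁ - θ₂‖) ∧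
    Differentiable ℝ (fun θ : EuclideanSpace ℝ (Fin S × Fin A) =>
      J γ c ρ (softmaxPolicy θ) p) ∧
    (∀ θ₁ θ₂ : EuclideanSpace ℝ (Fin S × Fin A),
        ‖gradient (fun θ : EuclideanSpace ℝ (Fin S × Fin A) =>
              J γ c ρ (softmaxPolicy θ) p) θ₁ -
            gradient (fun θ : EuclideanSpace ℝ (Fin S × Fin A) =>
              J γ c ρ (softmaxPolicy θ) p) θ₂‖ ≤
          8 / (1 - γ) ^ 3 * ‖θ₁ - θ₂‖) := by
  have hγ' : 0 < 1 - γ := by linarith [hγ.2]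
  have hdiff := differentiable_value_softmaxPolicy hA hγ hc hp
  have hJ : Differentiable ℝ (fun θ : EuclideanSpace ℝ (Fin S × Fin A) =>
      J γ c ρ (softmaxPolicy θ) p) :=
    Differentiable.fun_sum fun s _ => (hdiff s).const_mul (ρ s)
  refine ⟨fun θ₁ θ₂ => ?_, hJ, fun θ₁ θ₂ => ?_⟩
  · have h := abs_average_le hρ (abs_value_softmaxPolicy_sub_le hA hγ hc hp θ₁ θ₂)
    simp only [mul_sub, Finset.sum_sub_distrib] at h
    refine h.trans ?_
    have h2 : (1 : ℝ) ≤ Real.sqrt 2 := Real.one_le_sqrt.mpr one_le_two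
    calc 1 / (1 - γ) * ‖θ₁ - θ₂‖ / (1 - γ) = 1 / (1 - γ) ^ 2 * ‖θ₁ - θ₂‖ := by
          field_simp
      _ ≤ Real.sqrt 2 / (1 - γ) ^ 2 * ‖θ₁ - θ₂‖ := by gcongr
  · rw [gradient, gradient, ← map_sub, LinearIsometryEquiv.norm_map]
    refine ContinuousLinearMap.opNorm_le_bound _ (by positivity) fun u => ?_
    have hfd : ∀ θ, fderiv ℝ (fun θ : EuclideanSpace ℝ (Fin S × Fin A) =>
        J γ c ρ (softmaxPolicy θ) p) θ u =
        ∑ s, ρ s * fderiv ℝ (fun θ => value γ c (softmaxPolicy θ) p s) θ u := by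
      intro θ
      have h := HasFDerivAt.fun_sum (u := Finset.univ) fun s _ =>
        ((hdiff s θ).hasFDerivAt).const_mul (ρ s)
      change fderiv ℝ (fun θ => ∑ s, ρ s * value γ c (softmaxPolicy θ) p s) θ u = _
      rw [h.fderiv]
      simp
    rw [sub_apply, hfd, hfd, ← Finset.sum_sub_distrib]
    simp only [← mul_sub]
    exact abs_average_le hρ (abs_fderiv_value_softmaxPolicy_sub_le hA hγ hc hp θ₁ θ₂ u)

end RMDPStmt
end
end

section
/- Derivative of the return with respect to the transition kernel: fix a policy π ∈ Π and a transition kernel p. Then the extended return map has partial derivative, at p and for every triple (s,a,s'), ∂J_ρ(π,p)/∂p_{sas'} = (1/(1−γ)) · d^{π,p}_ρ(s) · π_{sa} · (c_{sas'} + γ v^{π,p}_{s'}). -/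
open scoped BigOperators

noncomputable section

namespace RMDPStmt

variable {S A : ℕ}

/-- Extended return `J_ρ(π,p) = ρᵀ (I - γ P^π)⁻¹ c^π`, defined for arbitrary
arrays `p` (agrees with the series definition on stochastic kernels). -/
def Jext {S A : ℕ} (γ : ℝ) (c : Fin S → Fin A → Fin S → ℝ) (ρ : Fin S → ℝ)
    (π : Fin S → Fin A → ℝ) (p : Fin S → Fin A → Fin S → ℝ) : ℝ :=
  ∑ s, ρ s * ((1 - γ • Pmat π p)⁻¹.mulVec (cvec c π p)) s

section Matrix

attribute [local instance] Matrix.linftyOpNormedRing Matrix.linftyOpNormedAlgebra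

variable {n : Type*} [Fintype n] [DecidableEq n]

theorem _root_.HasDerivAt.matrix_inv {B : ℝ → Matrix n n ℝ} {B' : Matrix n n ℝ} {x : ℝ}
    (hB : HasDerivAt B B' x) (hx : IsUnit (B x)) :
    HasDerivAt (fun y => (B y)⁻¹) (-((B x)⁻¹ * B' * (B x)⁻¹)) x := by
  obtain ⟨u, hu⟩ := hx
  have h := hasFDerivAt_ringInverse (𝕜 := ℝ) u
  rw [hu] at h
  have h2 := h.comp_hasDerivAt x hB
  simp only [Function.comp_def, ← Matrix.nonsing_inv_eq_ringInverse] at h2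
  refine HasDerivAt.congr_deriv h2 ?_
  simp [← hu, Matrix.coe_units_inv]

theorem linfty_opNorm_smul_lt_one {γ : ℝ} (hγ : γ ∈ Set.Ioo (0 : ℝ) 1) {P : Matrix n n ℝ}
    (hP : ∀ i, P i ∈ stdSimplex ℝ n) : ‖γ • P‖ < 1 := by
  have hP1 : ‖P‖ ≤ 1 := by
    rw [Matrix.linfty_opNorm_def, ← NNReal.coe_one, NNReal.coe_le_coe]
    refine Finset.sup_le fun i _ => ?_
    rw [← NNReal.coe_le_coe]
    push_cast
    refine le_of_eq ?_
    rw [← (hP i).2]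
    exact Finset.sum_congr rfl fun j _ => Real.norm_of_nonneg ((hP i).1 j)
  calc ‖γ • P‖ ≤ ‖γ‖ * ‖P‖ := norm_smul_le _ _
    _ ≤ ‖γ‖ * 1 := by gcongr
    _ < 1 := by rw [mul_one, Real.norm_of_nonneg hγ.1.le]; exact hγ.2

theorem isUnit_one_sub_smul {γ : ℝ} (hγ : γ ∈ Set.Ioo (0 : ℝ) 1) {P : Matrix n n ℝ}
    (hP : ∀ i, P i ∈ stdSimplex ℝ n) : IsUnit (1 - γ • P) :=
  isUnit_one_sub_of_norm_lt_one (linfty_opNorm_smul_lt_one hγ hP)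

theorem hasSum_smul_pow {γ : ℝ} (hγ : γ ∈ Set.Ioo (0 : ℝ) 1) {P : Matrix n n ℝ}
    (hP : ∀ i, P i ∈ stdSimplex ℝ n) :
    HasSum (fun t : ℕ => γ ^ t • P ^ t) (1 - γ • P)⁻¹ := by
  have h := hasSum_geom_series_inverse _ (linfty_opNorm_smul_lt_one hγ hP)
  simp only [smul_pow, ← Matrix.nonsing_inv_eq_ringInverse] at h
  exact h

theorem hasDerivAt_dotProduct_inv_mulVec {B : ℝ → Matrix n n ℝ} {B' : Matrix n n ℝ}
    {b : ℝ → n → ℝ} {b' : n → ℝ} {x : ℝ} (ρ : n → ℝ)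
    (hB : HasDerivAt B B' x) (hx : IsUnit (B x)) (hb : HasDerivAt b b' x) :
    HasDerivAt (fun y => ρ ⬝ᵥ ((B y)⁻¹.mulVec (b y)))
      (Matrix.vecMul ρ (B x)⁻¹ ⬝ᵥ (b' - B'.mulVec ((B x)⁻¹.mulVec (b x)))) x := by
  have hN := hB.matrix_inv hx
  have hent (i j : n) : HasDerivAt (fun y => (B y)⁻¹ i j)
      ((-((B x)⁻¹ * B' * (B x)⁻¹)) i j) x :=
    hasDerivAt_pi.1 (hasDerivAt_pi.1 hN i) j
  have h : HasDerivAt (fun y => ρ ⬝ᵥ ((B y)⁻¹.mulVec (b y)))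
      (ρ ⬝ᵥ ((-((B x)⁻¹ * B' * (B x)⁻¹)).mulVec (b x) + (B x)⁻¹.mulVec b')) x := by
    simp only [dotProduct, Matrix.mulVec, Pi.add_apply, ← Finset.sum_add_distrib]
    exact HasDerivAt.fun_sum fun i _ => (HasDerivAt.fun_sum fun j _ =>
      (hent i j).fun_mul (hasDerivAt_pi.1 hb j)).const_mul _
  convert h using 1
  rw [← Matrix.dotProduct_mulVec, Matrix.mulVec_sub, Matrix.neg_mulVec, Matrix.mulVec_mulVec,
    Matrix.mulVec_mulVec, neg_add_eq_sub]

end Matrix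

theorem Pmat_mem_stdSimplex {π : Fin S → Fin A → ℝ} {p : Fin S → Fin A → Fin S → ℝ}
    (hπ : IsPolicy π) (hp : IsKernel p) (s : Fin S) : Pmat π p s ∈ stdSimplex ℝ (Fin S) := by
  refine ⟨fun s' => show 0 ≤ ∑ a, π s a * p s a s' from Finset.sum_nonneg fun a _ => mul_nonneg ((hπ s).1 a) ((hp s a).1 s'), ?_⟩
  simp only [Pmat, Matrix.of_apply]
  rw [Finset.sum_comm]
  simp only [← Finset.mul_sum, (hp s _).2, mul_one, (hπ s).2]

theorem value_eq_inv_mulVec {γ : ℝ} (hγ : γ ∈ Set.Ioo (0 : ℝ) 1)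
    (c : Fin S → Fin A → Fin S → ℝ) {π : Fin S → Fin A → ℝ} {p : Fin S → Fin A → Fin S → ℝ}
    (hπ : IsPolicy π) (hp : IsKernel p) :
    value γ c π p = (1 - γ • Pmat π p)⁻¹.mulVec (cvec c π p) := by
  ext s
  have h := hasSum_smul_pow hγ (Pmat_mem_stdSimplex hπ hp)
  have h2 := hasSum_sum (s := Finset.univ) fun (j : Fin S) _ =>
    (Pi.hasSum.1 (Pi.hasSum.1 h s) j).mul_right (cvec c π p j)
  rw [value, Matrix.mulVec, dotProduct, ← h2.tsum_eq]
  simp [Matrix.mulVec, dotProduct, Finset.mul_sum, mul_assoc]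

theorem occ_eq_vecMul_inv {γ : ℝ} (hγ : γ ∈ Set.Ioo (0 : ℝ) 1)
    (ρ : Fin S → ℝ) {π : Fin S → Fin A → ℝ} {p : Fin S → Fin A → Fin S → ℝ}
    (hπ : IsPolicy π) (hp : IsKernel p) (s : Fin S) :
    occ γ ρ π p s = (1 - γ) * Matrix.vecMul ρ (1 - γ • Pmat π p)⁻¹ s := by
  have h := hasSum_smul_pow hγ (Pmat_mem_stdSimplex hπ hp)
  have h2 := hasSum_sum (s := Finset.univ) fun (i : Fin S) _ =>
    (Pi.hasSum.1 (Pi.hasSum.1 h i) s).mul_left (ρ i)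
  rw [occ, Matrix.vecMul, dotProduct, ← h2.tsum_eq]
  simp [Finset.mul_sum, mul_left_comm]

theorem hasDerivAt_update_entry (p : Fin S → Fin A → Fin S → ℝ) (s : Fin S) (a : Fin A)
    (s' i : Fin S) (b : Fin A) (j : Fin S) (x : ℝ) :
    HasDerivAt (fun y : ℝ => if i = s ∧ b = a ∧ j = s' then y else p i b j)
      (if i = s ∧ b = a ∧ j = s' then 1 else 0) x := by
  split_ifs
  · exact hasDerivAt_id x
  · exact hasDerivAt_const x _

/-- Derivative of the return with respect to the transition kernel:
`∂J_ρ(π,p)/∂p_{sas'} = (1/(1−γ)) d^{π,p}_ρ(s) π_{sa} (c_{sas'} + γ v^{π,p}_{s'})`. -/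
theorem return_partial_derivative_in_transition
    {S A : ℕ} (hS : 0 < S) (hA : 0 < A)
    (γ : ℝ) (hγ : γ ∈ Set.Ioo (0 : ℝ) 1)
    (c : Fin S → Fin A → Fin S → ℝ)
    (hc : ∀ s a s', c s a s' ∈ Set.Icc (0 : ℝ) 1)
    (ρ : Fin S → ℝ) (hρ : ρ ∈ stdSimplex ℝ (Fin S))
    (π : Fin S → Fin A → ℝ) (hπ : IsPolicy π)
    (p : Fin S → Fin A → Fin S → ℝ) (hp : IsKernel p) :
    ∀ s a s', HasDerivAt
      (fun x : ℝ => Jext γ c ρ π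
        (fun s1 a1 s1' => if s1 = s ∧ a1 = a ∧ s1' = s' then x else p s1 a1 s1'))
      (1 / (1 - γ) * occ γ ρ π p s * π s a *
        (c s a s' + γ * value γ c π p s'))
      (p s a s') := by
  intro s a s'
  set q : ℝ → Fin S → Fin A → Fin S → ℝ := fun x s1 a1 s1' =>
    if s1 = s ∧ a1 = a ∧ s1' = s' then x else p s1 a1 s1' with hq
  have hq0 : q (p s a s') = p := by
    ext i b j
    simp only [hq]
    split_ifs with h
    · obtain ⟨rfl, rfl, rfl⟩ := h; rfl
    · rfl
  have hP : HasDerivAt (fun x => 1 - γ • Pmat π (q x))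
      (Matrix.single s s' (-(γ * π s a))) (p s a s') := by
    refine hasDerivAt_pi.2 fun i => hasDerivAt_pi.2 fun j => ?_
    have h := ((HasDerivAt.fun_sum (u := Finset.univ) fun b _ =>
      (hasDerivAt_update_entry p s a s' i b j (p s a s')).const_mul (π i b)).const_mul γ).const_sub
        ((1 : Matrix (Fin S) (Fin S) ℝ) i j)
    refine HasDerivAt.congr_deriv h ?_
    rw [Matrix.single_apply]
    by_cases hi : i = s <;> by_cases hj : j = s' <;>
      simp [hi, hj, Ne.symm]
  have hc' : HasDerivAt (fun x => cvec c π (q x))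
      (Pi.single s (π s a * c s a s')) (p s a s') := by
    refine hasDerivAt_pi.2 fun i => ?_
    have h := HasDerivAt.fun_sum (u := Finset.univ) fun b _ =>
      (HasDerivAt.fun_sum (u := Finset.univ) fun j _ =>
        (hasDerivAt_update_entry p s a s' i b j (p s a s')).mul_const (c i b j)).const_mul (π i b)
    refine HasDerivAt.congr_deriv h ?_
    by_cases hi : i = s
    · subst hi
      simp [ite_and]
    · simp [hi]
  have hU : IsUnit (1 - γ • Pmat π (q (p s a s'))) := by
    rw [hq0]; exact isUnit_one_sub_smul hγ (Pmat_mem_stdSimplex hπ hp)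
  have h := hasDerivAt_dotProduct_inv_mulVec ρ hP hU hc'
  rw [hq0, ← value_eq_inv_mulVec hγ c hπ hp] at h
  refine h.congr_deriv ?_
  have hγ1 : 1 - γ ≠ 0 := sub_ne_zero.2 hγ.2.ne'
  rw [occ_eq_vecMul_inv hγ ρ hπ hp, Matrix.single_mulVec, dotProduct_sub, dotProduct_single,
    ← Pi.single, dotProduct_single]
  field_simp
  ring

end RMDPStmt
end
end

section
/- Second performance difference lemma across transition kernels: for any policy π ∈ Π and any two transition kernels p, p', J_ρ(π,p) − J_ρ(π,p') = (1/(1−γ)) Σ_s d^{π,p}_ρ(s) Σ_a π_{sa} Σ_{s'} (p_{sas'} − p'_{sas'}) · (c_{sas'} + γ v^{π,p'}_{s'}). -/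
open scoped BigOperators

noncomputable section

namespace RMDPStmt

variable {S A : ℕ}

/-- Averaging the rows of a kernel over a policy gives a row stochastic matrix. -/
lemma Pmat_mem_rowStochastic {π : Fin S → Fin A → ℝ} {p : Fin S → Fin A → Fin S → ℝ}
    (hπ : IsPolicy π) (hp : IsKernel p) :
    Pmat π p ∈ Matrix.rowStochastic ℝ (Fin S) := by
  rw [Matrix.mem_rowStochastic_iff_sum]
  simp only [Pmat, Matrix.of_apply]
  refine ⟨fun s s' => Finset.sum_nonneg fun a _ => mul_nonneg ((hπ s).1 a) ((hp s a).1 s'),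
    fun s => ?_⟩
  rw [Finset.sum_comm]
  simp only [← Finset.mul_sum, (hp s _).2, mul_one, (hπ s).2]

/-- The discounted powers of a row stochastic matrix are summable. -/
lemma summable_smul_pow_of_mem_rowStochastic {n : Type*} [Fintype n] [DecidableEq n]
    {γ : ℝ} (h0 : 0 ≤ γ) (h1 : γ < 1) {M : Matrix n n ℝ}
    (hM : M ∈ Matrix.rowStochastic ℝ n) :
    Summable fun t : ℕ => (γ • M) ^ t := by
  refine Pi.summable.2 fun i => Pi.summable.2 fun j => ?_
  refine Summable.of_nonneg_of_le (fun t => ?_) (fun t => ?_)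
    (summable_geometric_of_lt_one h0 h1)
  all_goals
    have hMt : M ^ t ∈ Matrix.rowStochastic ℝ n := pow_mem hM t
    rw [smul_pow, Matrix.smul_apply, smul_eq_mul]
  · exact mul_nonneg (pow_nonneg h0 t) (Matrix.nonneg_of_mem_rowStochastic hMt)
  · exact mul_le_of_le_one_right (pow_nonneg h0 t) (Matrix.le_one_of_mem_rowStochastic hMt)

/-- The resolvent `∑ γ^t (P^π)^t`. -/
def resolvent (γ : ℝ) (π : Fin S → Fin A → ℝ) (p : Fin S → Fin A → Fin S → ℝ) :
    Matrix (Fin S) (Fin S) ℝ :=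
  ∑' t : ℕ, (γ • Pmat π p) ^ t

section Resolvent

variable {γ : ℝ} {π : Fin S → Fin A → ℝ} {p : Fin S → Fin A → Fin S → ℝ}

lemma hasSum_resolvent (h : Summable fun t : ℕ => (γ • Pmat π p) ^ t) (i j : Fin S) :
    HasSum (fun t : ℕ => γ ^ t * (Pmat π p ^ t) i j) (resolvent γ π p i j) := by
  simpa only [resolvent, smul_pow, Matrix.smul_apply, smul_eq_mul] using
    Pi.hasSum.1 (Pi.hasSum.1 h.hasSum i) j

lemma value_eq_resolvent_mulVec (h : Summable fun t : ℕ => (γ • Pmat π p) ^ t)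
    (c : Fin S → Fin A → Fin S → ℝ) :
    value γ c π p = (resolvent γ π p).mulVec (cvec c π p) := by
  funext s
  refine HasSum.tsum_eq ?_
  simp only [Matrix.mulVec, dotProduct, Finset.mul_sum, ← mul_assoc]
  exact hasSum_sum fun j _ => (hasSum_resolvent h s j).mul_right _

lemma occ_eq_vecMul_resolvent (h : Summable fun t : ℕ => (γ • Pmat π p) ^ t)
    (ρ : Fin S → ℝ) :
    occ γ ρ π p = (1 - γ) • Matrix.vecMul ρ (resolvent γ π p) := by
  funext s
  simp only [occ, Pi.smul_apply, smul_eq_mul]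
  congr 1
  refine HasSum.tsum_eq ?_
  simp only [Matrix.vecMul, dotProduct, Finset.mul_sum, mul_left_comm (γ ^ _)]
  exact hasSum_sum fun i _ => (hasSum_resolvent h i s).mul_left _

/-- The Bellman equation for the value function of a policy. -/
lemma value_eq_cvec_add_s9 (h : Summable fun t : ℕ => (γ • Pmat π p) ^ t)
    (c : Fin S → Fin A → Fin S → ℝ) :
    value γ c π p = cvec c π p + γ • (Pmat π p).mulVec (value γ c π p) := by
  have hB : (1 - γ • Pmat π p).mulVec (value γ c π p) = cvec c π p := by
    rw [value_eq_resolvent_mulVec h, Matrix.mulVec_mulVec, resolvent,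
      h.one_sub_mul_tsum_pow, Matrix.one_mulVec]
  rw [Matrix.sub_mulVec, Matrix.one_mulVec, Matrix.smul_mulVec] at hB
  exact sub_eq_iff_eq_add.1 hB

end Resolvent

/-- One-step look-ahead with continuation values `v`, averaged over the policy. -/
lemma sum_policy_mul_sum_kernel (γ : ℝ) (c : Fin S → Fin A → Fin S → ℝ)
    (π : Fin S → Fin A → ℝ) (p : Fin S → Fin A → Fin S → ℝ) (v : Fin S → ℝ) (s : Fin S) :
    ∑ a, π s a * ∑ s', p s a s' * (c s a s' + γ * v s') =
      (cvec c π p + γ • (Pmat π p).mulVec v) s := by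
  simp only [cvec, Pmat, Pi.add_apply, Pi.smul_apply, smul_eq_mul, Matrix.mulVec, dotProduct,
    Matrix.of_apply, mul_add, Finset.sum_add_distrib, Finset.mul_sum, Finset.sum_mul]
  congr 1
  rw [Finset.sum_comm]
  exact Finset.sum_congr rfl fun _ _ => Finset.sum_congr rfl fun _ _ => by ring

/-- Second performance difference lemma across transition kernels. -/
theorem second_performance_difference_across_kernels
    {S A : ℕ} (hS : 0 < S) (hA : 0 < A)
    (γ : ℝ) (hγ : γ ∈ Set.Ioo (0 : ℝ) 1)
    (c : Fin S → Fin A → Fin S → ℝ)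
    (hc : ∀ s a s', c s a s' ∈ Set.Icc (0 : ℝ) 1)
    (ρ : Fin S → ℝ) (hρ : ρ ∈ stdSimplex ℝ (Fin S))
    (π : Fin S → Fin A → ℝ) (hπ : IsPolicy π)
    (p p' : Fin S → Fin A → Fin S → ℝ)
    (hp : IsKernel p) (hp' : IsKernel p') :
    J γ c ρ π p - J γ c ρ π p' =
      (1 / (1 - γ)) * ∑ s, occ γ ρ π p s *
        ∑ a, π s a * ∑ s', (p s a s' - p' s a s') *
          (c s a s' + γ * value γ c π p' s') := by
  have h := summable_smul_pow_of_mem_rowStochastic hγ.1.le hγ.2 (Pmat_mem_rowStochastic hπ hp)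
  have h' := summable_smul_pow_of_mem_rowStochastic hγ.1.le hγ.2 (Pmat_mem_rowStochastic hπ hp')
  have hγ1 : 1 - γ ≠ 0 := (sub_pos.2 hγ.2).ne'
  set v' := value γ c π p' with hv'
  have hstep : (fun s => ∑ a, π s a * ∑ s', (p s a s' - p' s a s') * (c s a s' + γ * v' s')) =
      cvec c π p - (1 - γ • Pmat π p).mulVec v' := by
    funext s
    simp only [sub_mul, Finset.sum_sub_distrib, mul_sub, sum_policy_mul_sum_kernel]
    rw [← value_eq_cvec_add_s9 h' c, ← hv']
    simp only [Matrix.sub_mulVec, Matrix.one_mulVec, Matrix.smul_mulVec, Pi.sub_apply,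
      Pi.add_apply]
    ring
  have hR : resolvent γ π p * (1 - γ • Pmat π p) = 1 := h.tsum_pow_mul_one_sub
  change ρ ⬝ᵥ value γ c π p - ρ ⬝ᵥ v' = 1 / (1 - γ) * (occ γ ρ π p ⬝ᵥ
    fun s => ∑ a, π s a * ∑ s', (p s a s' - p' s a s') * (c s a s' + γ * v' s'))
  rw [hstep, occ_eq_vecMul_resolvent h, smul_dotProduct, smul_eq_mul, ← mul_assoc,
    one_div_mul_cancel hγ1, one_mul, ← Matrix.dotProduct_mulVec, Matrix.mulVec_sub,
    Matrix.mulVec_mulVec, hR, Matrix.one_mulVec, dotProduct_sub, value_eq_resolvent_mulVec h]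

end RMDPStmt
end
end
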